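/- Let R0 = ℤ[a2001, a1200, a1110, a1101, a0210] and let X, Y be two further variables. For every integer n ≥ 1, write (q0^{(n)}, q1^{(n)}, q2^{(n)}, q3^{(n)}) for the result of applying the polynomial map G n times, starting from the 4-tuple (X, Y, 0, 0) ∈ R0[X,Y]⁴. Then q0^{(n)} ≠ 0 and q1^{(n)} ≠ 0; in particular, for every n ≥ 1 the 4-tuple obtained by applying G n times to (X, Y, 0, 0) is not the zero tuple. -/

import Mathlib

/- STATEMENT 12: Corollary 3.10 of the paper (polynomial-representative form).
R0 = ℤ[a2001, a1200, a1110, a1101, a0210] = MvPolynomial (Fin 5) ℤ (variables indexed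
0,…,4 in that order); R0[X,Y] = MvPolynomial (Fin 2) R0 with X = X 0 and Y = X 1.
G is iterated n times (Function.iterate) starting from the tuple (X, Y, 0, 0).
The cubic f, the Blanc involution tuples σ1, σ2, σ3 and the composite substitution
G = σ1 ∘ σ2 ∘ σ3 are defined below. -/

open MvPolynomial

noncomputable section

variable {A : Type} [CommRing A]

/-- The cubic form f = a2001·x0²x3 + a1200·x0x1² + a1110·x0x1x2 + a1101·x0x1x3 + a0210·x1²x2,
with coefficients a = (a2001, a1200, a1110, a1101, a0210) : Fin 5 → A. -/
def cub (a : Fin 5 → A) : MvPolynomial (Fin 4) A :=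
  C (a 0) * X 0 ^ 2 * X 3 + C (a 1) * X 0 * X 1 ^ 2 + C (a 2) * X 0 * X 1 * X 2 +
    C (a 3) * X 0 * X 1 * X 3 + C (a 4) * X 1 ^ 2 * X 2

/-- The Blanc involution tuple σ1 = (x0·∂f/∂x1, x1·∂f/∂x1 − 2f, x2·∂f/∂x1, x3·∂f/∂x1). -/
def sig1 (a : Fin 5 → A) : Fin 4 → MvPolynomial (Fin 4) A :=
  ![X 0 * pderiv 1 (cub a), X 1 * pderiv 1 (cub a) - 2 * cub a,
    X 2 * pderiv 1 (cub a), X 3 * pderiv 1 (cub a)]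

/-- The Blanc involution tuple σ2. -/
def sig2 (a : Fin 5 → A) : Fin 4 → MvPolynomial (Fin 4) A :=
  ![X 0 * pderiv 2 (cub a), X 1 * pderiv 2 (cub a),
    X 2 * pderiv 2 (cub a) - 2 * cub a, X 3 * pderiv 2 (cub a)]

/-- The Blanc involution tuple σ3. -/
def sig3 (a : Fin 5 → A) : Fin 4 → MvPolynomial (Fin 4) A :=
  ![X 0 * pderiv 3 (cub a), X 1 * pderiv 3 (cub a),
    X 2 * pderiv 3 (cub a), X 3 * pderiv 3 (cub a) - 2 * cub a]

/-- G(v) = σ1(σ2(σ3(v))): substitute v into σ3, the result into σ2, that into σ1. -/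
def Gmap (a : Fin 5 → A) (v : Fin 4 → A) : Fin 4 → A :=
  fun i => eval (fun j => eval (fun k => eval v (sig3 a k)) (sig2 a j)) (sig1 a i)

abbrev R₀ : Type := MvPolynomial (Fin 5) ℤ
abbrev RXY : Type := MvPolynomial (Fin 2) R₀

/-- The coefficients a2001, …, a0210 of R0, viewed in R0[X,Y]. -/
noncomputable def aC : Fin 5 → RXY := fun i => C (X i)

/-- The cubic evaluated at a point. -/
def fv (a : Fin 5 → A) (x : Fin 4 → A) : A :=
  a 0 * x 0 ^ 2 * x 3 + a 1 * x 0 * x 1 ^ 2 + a 2 * x 0 * x 1 * x 2 +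
    a 3 * x 0 * x 1 * x 3 + a 4 * x 1 ^ 2 * x 2

def d1 (a : Fin 5 → A) (x : Fin 4 → A) : A :=
  2 * a 1 * x 0 * x 1 + a 2 * x 0 * x 2 + a 3 * x 0 * x 3 + 2 * a 4 * x 1 * x 2

def d2 (a : Fin 5 → A) (x : Fin 4 → A) : A := a 2 * x 0 * x 1 + a 4 * x 1 ^ 2

def d3 (a : Fin 5 → A) (x : Fin 4 → A) : A := a 0 * x 0 ^ 2 + a 3 * x 0 * x 1

def g1 (a : Fin 5 → A) (x : Fin 4 → A) : Fin 4 → A :=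
  ![x 0 * d1 a x, x 1 * d1 a x - 2 * fv a x, x 2 * d1 a x, x 3 * d1 a x]

def g2 (a : Fin 5 → A) (x : Fin 4 → A) : Fin 4 → A :=
  ![x 0 * d2 a x, x 1 * d2 a x, x 2 * d2 a x - 2 * fv a x, x 3 * d2 a x]

def g3 (a : Fin 5 → A) (x : Fin 4 → A) : Fin 4 → A :=
  ![x 0 * d3 a x, x 1 * d3 a x, x 2 * d3 a x, x 3 * d3 a x - 2 * fv a x]

theorem eval_cub (a : Fin 5 → A) (x : Fin 4 → A) : eval x (cub a) = fv a x := by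
  simp [cub, fv]

theorem eval_d1 (a : Fin 5 → A) (x : Fin 4 → A) : eval x (pderiv 1 (cub a)) = d1 a x := by
  simp [cub, d1, pderiv_X]
  ring

theorem eval_d2 (a : Fin 5 → A) (x : Fin 4 → A) : eval x (pderiv 2 (cub a)) = d2 a x := by
  simp [cub, d2, pderiv_X]

theorem eval_d3 (a : Fin 5 → A) (x : Fin 4 → A) : eval x (pderiv 3 (cub a)) = d3 a x := by
  simp [cub, d3, pderiv_X]

theorem Gmap_eq (a : Fin 5 → A) (v : Fin 4 → A) : Gmap a v = g1 a (g2 a (g3 a v)) := by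
  have h1 : ∀ x : Fin 4 → A, (fun i => eval x (sig1 a i)) = g1 a x := by
    intro x; funext i
    fin_cases i <;> simp [sig1, g1, eval_cub, eval_d1]
  have h2 : ∀ x : Fin 4 → A, (fun i => eval x (sig2 a i)) = g2 a x := by
    intro x; funext i
    fin_cases i <;> simp [sig2, g2, eval_cub, eval_d2]
  have h3 : ∀ x : Fin 4 → A, (fun i => eval x (sig3 a i)) = g3 a x := by
    intro x; funext i
    fin_cases i <;> simp [sig3, g3, eval_cub, eval_d3]
  rw [← h3, ← h2, ← h1]
  rfl

theorem Gmap_map {B : Type} [CommRing B] (φ : A →+* B) (a : Fin 5 → A) (v : Fin 4 → A) :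
    (fun i => φ (Gmap a v i)) = Gmap (fun i => φ (a i)) (fun i => φ (v i)) := by
  have hφ : φ 2 = 2 := map_ofNat φ 2
  have h1 : ∀ x : Fin 4 → A, (fun i => φ (g1 a x i)) = g1 (fun i => φ (a i)) (fun i => φ (x i)) := by
    intro x; funext i
    fin_cases i <;> simp [g1, fv, d1, hφ]
  have h2 : ∀ x : Fin 4 → A, (fun i => φ (g2 a x i)) = g2 (fun i => φ (a i)) (fun i => φ (x i)) := by
    intro x; funext i
    fin_cases i <;> simp [g2, fv, d2, hφ]
  have h3 : ∀ x : Fin 4 → A, (fun i => φ (g3 a x i)) = g3 (fun i => φ (a i)) (fun i => φ (x i)) := by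
    intro x; funext i
    fin_cases i <;> simp [g3, fv, d3, hφ]
  rw [Gmap_eq, Gmap_eq, h1, h2, h3]

theorem Gmap_iter_map {B : Type} [CommRing B] (φ : A →+* B) (a : Fin 5 → A) (v : Fin 4 → A)
    (n : ℕ) : (fun i => φ ((Gmap a)^[n] v i)) =
      (Gmap (fun i => φ (a i)))^[n] (fun i => φ (v i)) := by
  induction n with
  | zero => rfl
  | succ k ih =>
    rw [Function.iterate_succ_apply', Function.iterate_succ_apply', ← ih, Gmap_map]

/-- The specialised coefficients. -/
def bC : Fin 5 → A := ![1, 1, 0, 1, 1]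

theorem g3_b (c p q z w : A) : g3 bC ![c * p, c * q, c * (2 * z), c * (2 * w)] =
    ![c ^ 3 * (p * (p ^ 2 + p * q)), c ^ 3 * (q * (p ^ 2 + p * q)),
      c ^ 3 * (2 * (z * (p ^ 2 + p * q))),
      c ^ 3 * (2 * (w * (p ^ 2 + p * q) -
        (p * q ^ 2 + 2 * (p ^ 2 * w + p * q * w + q ^ 2 * z))))] := by
  funext i
  fin_cases i <;> simp [g3, fv, d3, bC] <;> ring

theorem g2_b (c p q z w : A) : g2 bC ![c * p, c * q, c * (2 * z), c * (2 * w)] =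
    ![c ^ 3 * (p * q ^ 2), c ^ 3 * (q * q ^ 2),
      c ^ 3 * (2 * (z * q ^ 2 - (p * q ^ 2 + 2 * (p ^ 2 * w + p * q * w + q ^ 2 * z)))),
      c ^ 3 * (2 * (w * q ^ 2))] := by
  funext i
  fin_cases i <;> simp [g2, fv, d2, bC] <;> ring

theorem g1_b (c p q z w : A) : g1 bC ![c * p, c * q, c * (2 * z), c * (2 * w)] =
    ![(2 * c ^ 3) * (p * (p * q + p * w + 2 * q * z)),
      (2 * c ^ 3) * (q * (p * q + p * w + 2 * q * z) -
        (p * q ^ 2 + 2 * (p ^ 2 * w + p * q * w + q ^ 2 * z))),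
      (2 * c ^ 3) * (2 * (z * (p * q + p * w + 2 * q * z))),
      (2 * c ^ 3) * (2 * (w * (p * q + p * w + 2 * q * z)))] := by
  funext i
  fin_cases i <;> simp [g1, fv, d1, bC] <;> ring

/-- Reduction modulo 2. -/
def red : Polynomial ℤ →+* Polynomial (ZMod 2) := Polynomial.mapRingHom (Int.castRingHom (ZMod 2))

theorem two_zero : (2 : Polynomial (ZMod 2)) = 0 := CharTwo.two_eq_zero

/-- The invariant. -/
def OrbInv (v : Fin 4 → Polynomial ℤ) : Prop :=
  ∃ c p q z w : Polynomial ℤ, c ≠ 0 ∧ v = ![c * p, c * q, c * (2 * z), c * (2 * w)] ∧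
    ∃ m p₀ q₀ w₀ : Polynomial (ZMod 2), m ≠ 0 ∧ p₀ ≠ 0 ∧
      red p = m * (Polynomial.X * p₀) ∧ red q = m * q₀ ∧ red w = m * (Polynomial.X * w₀) ∧
      q₀.eval 0 = 1 ∧ p₀.eval 0 + w₀.eval 0 = 1

theorem ne_of_eval {q : Polynomial (ZMod 2)} (h : q.eval 0 = 1) : q ≠ 0 := by
  rintro rfl
  simp at h

theorem Inv_step (v : Fin 4 → Polynomial ℤ) (h : OrbInv v) : OrbInv (Gmap bC v) := by
  obtain ⟨c, p, q, z, w, hc, rfl, m, p₀, q₀, w₀, hm, hp₀, hp, hq, hw, hq1, hpw⟩ := h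
  rw [Gmap_eq, g3_b, g2_b, g1_b]
  refine ⟨_, _, _, _, _, ?_, rfl, ?_⟩
  · have h2 : (2 : Polynomial ℤ) ≠ 0 := two_ne_zero
    exact mul_ne_zero h2 (pow_ne_zero _ (pow_ne_zero _ (pow_ne_zero _ hc)))
  have h2 := two_zero
  set t : Polynomial (ZMod 2) := Polynomial.X with ht
  have ht0 : t ≠ 0 := Polynomial.X_ne_zero
  have hte : t.eval 0 = 0 := Polynomial.eval_X
  set e := q₀ + t * p₀ with he
  set g := t * w₀ * e - q₀ ^ 2 with hg
  set k := p₀ * q₀ + w₀ * e with hk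
  have hee : e.eval 0 = 1 := by simp [he, hte, hq1]
  have hge : g.eval 0 = 1 := by simp [hg, hte, hq1, CharTwo.neg_eq]
  have hke : k.eval 0 = 1 := by simp [hk, hq1, hee, hpw]
  have hq0 := ne_of_eval hq1
  have he0 := ne_of_eval hee
  have hk0 := ne_of_eval hke
  refine ⟨(m * (t * p₀) * ((m * (t * p₀)) * (m * q₀) * (m * e)) ^ 2) ^ 3 * (m * (t * p₀) * (m * e)) * m ^ 4, t * p₀ * e * k, q₀ * e * g, g * k, ?_, ?_, ?_, ?_, ?_, ?_, ?_⟩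
  · simp [hm, ht0, hp₀, hq0, he0]
  · simp [hp₀, ht0, he0, hk0]
  · simp only [map_mul, map_add, map_sub, map_pow, map_ofNat, hp, hq, hw, h2]
    rw [hk, he]
    ring
  · simp only [map_mul, map_add, map_sub, map_pow, map_ofNat, hp, hq, hw, h2]
    rw [hg, he]
    ring
  · simp only [map_mul, map_add, map_sub, map_pow, map_ofNat, hp, hq, hw, h2]
    rw [hg, hk, he]
    ring
  · simp [hq1, hee, hge]
  · simp [hte, hge, hke]

theorem Inv_ne (v : Fin 4 → Polynomial ℤ) (h : OrbInv v) : v 0 ≠ 0 ∧ v 1 ≠ 0 := by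
  obtain ⟨c, p, q, z, w, hc, rfl, m, p₀, q₀, w₀, hm, hp₀, hp, hq, hw, hq1, hpw⟩ := h
  have hp' : p ≠ 0 := by
    rintro rfl
    rw [map_zero] at hp
    exact mul_ne_zero hm (mul_ne_zero Polynomial.X_ne_zero hp₀) hp.symm
  have hq' : q ≠ 0 := by
    rintro rfl
    rw [map_zero] at hq
    exact mul_ne_zero hm (ne_of_eval hq1) hq.symm
  exact ⟨mul_ne_zero hc hp', mul_ne_zero hc hq'⟩

theorem Inv_start : OrbInv ![Polynomial.X, 1, 0, 0] := by
  refine ⟨1, Polynomial.X, 1, 0, 0, one_ne_zero, by simp, 1, 1, 1, 0, one_ne_zero, one_ne_zero,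
    ?_, ?_, ?_, ?_, ?_⟩ <;> simp [red]

theorem Inv_iter (n : ℕ) : OrbInv ((Gmap bC)^[n] ![Polynomial.X, 1, 0, 0]) := by
  induction n with
  | zero => exact Inv_start
  | succ k ih =>
    rw [Function.iterate_succ_apply']
    exact Inv_step _ ih

/-- The specialisation homomorphism. -/
def spec : RXY →+* Polynomial ℤ :=
  eval₂Hom (eval₂Hom (Int.castRingHom (Polynomial ℤ)) bC) ![Polynomial.X, 1]

theorem stmt_12 (n : ℕ) (hn : 1 ≤ n) :
    ((Gmap aC)^[n] ![X 0, X 1, 0, 0]) 0 ≠ 0 ∧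
    ((Gmap aC)^[n] ![X 0, X 1, 0, 0]) 1 ≠ 0 ∧
    (Gmap aC)^[n] ![X 0, X 1, 0, 0] ≠ 0 := by
  have key : (fun i => spec ((Gmap aC)^[n] ![X 0, X 1, 0, 0] i)) =
      (Gmap bC)^[n] ![Polynomial.X, 1, 0, 0] := by
    rw [Gmap_iter_map]
    congr 2
    · funext i
      simp [spec, aC]
    · funext i
      fin_cases i <;> simp [spec]
  obtain ⟨h0, h1⟩ := Inv_ne _ (Inv_iter n)
  rw [← key] at h0 h1
  have h0' : ((Gmap aC)^[n] ![X 0, X 1, 0, 0]) 0 ≠ 0 := fun h => h0 (by simp [h])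
  have h1' : ((Gmap aC)^[n] ![X 0, X 1, 0, 0]) 1 ≠ 0 := fun h => h1 (by simp [h])
  exact ⟨h0', h1', fun h => h0' (by rw [h]; rfl)⟩
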